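/- Let π : F_n → W_n be the natural epimorphism from the free group on f_1,…,f_n to the universal Coxeter group on s_1,…,s_n sending f_i ↦ s_i. Then the induced map π^n : Red_R(g) → Red_T(c) (applying π coordinatewise, where g = f_1⋯f_n and c = s_1⋯s_n) is a bijection, and it is equivariant for the Hurwitz actions of B_n on both sets. -/

import Mathlib

/-- The elementary Hurwitz move `σ_i` on `n`-tuples of a group `G`
(0-indexed: acts on entries `i` and `i+1`). -/
def hmove (n : ℕ) (G : Type*) [Group G] (i : ℕ) (hi : i + 1 < n)
    (g : Fin n → G) : Fin n → G := fun j =>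
  if (j : ℕ) = i then g ⟨i, by omega⟩ * g ⟨i + 1, hi⟩ * (g ⟨i, by omega⟩)⁻¹
  else if (j : ℕ) = i + 1 then g ⟨i, by omega⟩
  else g j

/-- One elementary step of the Hurwitz action. -/
def hstep (n : ℕ) (G : Type*) [Group G] (a b : Fin n → G) : Prop :=
  ∃ (i : ℕ) (hi : i + 1 < n), b = hmove n G i hi a

/-- Braid relations: generators `σ_1, …, σ_{n-1}` indexed by `Fin (n-1)`. -/
def braidRels (n : ℕ) : Set (FreeGroup (Fin (n - 1))) :=
  { r | (∃ i j : Fin (n - 1), (i : ℕ) + 1 = (j : ℕ) ∧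
          r = FreeGroup.of i * FreeGroup.of j * FreeGroup.of i *
            (FreeGroup.of j * FreeGroup.of i * FreeGroup.of j)⁻¹) ∨
        (∃ i j : Fin (n - 1), (i : ℕ) + 1 < (j : ℕ) ∧
          r = FreeGroup.of i * FreeGroup.of j * (FreeGroup.of j * FreeGroup.of i)⁻¹) }

/-- The braid group `B_n`. -/
abbrev BraidGroup (n : ℕ) := PresentedGroup (braidRels n)

/-- Relations of the universal Coxeter group: each generator squares to 1. -/
def coxRels (n : ℕ) : Set (FreeGroup (Fin n)) :=
  { r | ∃ i, r = FreeGroup.of i * FreeGroup.of i }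

/-- The universal Coxeter group `W_n`. -/
abbrev UCox (n : ℕ) := PresentedGroup (coxRels n)

/-- The generator `s_i` of `W_n`. -/
def sgen {n : ℕ} (i : Fin n) : UCox n := PresentedGroup.of i

/-- The Coxeter element `c = s_1 ⋯ s_n`. -/
def coxElt (n : ℕ) : UCox n := (List.ofFn fun i => sgen i).prod

/-- The set `T` of reflections of `W_n`: conjugates of generators. -/
def Refl (n : ℕ) : Set (UCox n) := { t | ∃ w i, t = w * sgen i * w⁻¹ }

/-- `Red_T(c)`: `n`-tuples of reflections with product `c`. -/
def RedT (n : ℕ) : Set (Fin n → UCox n) :=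
  { t | (∀ i, t i ∈ Refl n) ∧ (List.ofFn t).prod = coxElt n }

/-- The set `R` of braid reflections of the free group: conjugates of generators. -/
def Rset (n : ℕ) : Set (FreeGroup (Fin n)) :=
  { r | ∃ w i, r = w * FreeGroup.of i * w⁻¹ }

/-- `g = f_1 ⋯ f_n`. -/
def gElt (n : ℕ) : FreeGroup (Fin n) := (List.ofFn fun i => FreeGroup.of i).prod

/-- `Red_R(g)`: `n`-tuples from `R` with product `g`. -/
def RedR (n : ℕ) : Set (Fin n → FreeGroup (Fin n)) :=
  { t | (∀ i, t i ∈ Rset n) ∧ (List.ofFn t).prod = gElt n }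

/-- The canonical projection `π : F_n → W_n`, `f_i ↦ s_i`. -/
def pr (n : ℕ) : FreeGroup (Fin n) →* UCox n := FreeGroup.lift fun i => sgen i

/-- Length of an element of `W_n`: the length of its normal form. -/
noncomputable def wordLength {n : ℕ} (w : UCox n) : ℕ :=
  sInf { m | ∃ l : List (Fin n),
    List.Chain' (· ≠ ·) l ∧ l.length = m ∧ (l.map sgen).prod = w }

/-! ### Hurwitz moves and their inverses -/

/-- The inverse of the elementary Hurwitz move `hmove`. -/
def hmoveInv (n : ℕ) (G : Type*) [Group G] (i : ℕ) (hi : i + 1 < n)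
    (g : Fin n → G) : Fin n → G := fun j =>
  if (j : ℕ) = i then g ⟨i + 1, hi⟩
  else if (j : ℕ) = i + 1 then (g ⟨i + 1, hi⟩)⁻¹ * g ⟨i, by omega⟩ * g ⟨i + 1, hi⟩
  else g j

section Hurwitz

variable {n : ℕ} {G H : Type*} [Group G] [Group H]

theorem hmove_hmoveInv (i : ℕ) (hi : i + 1 < n) (t : Fin n → G) :
    hmove n G i hi (hmoveInv n G i hi t) = t := by
  funext ⟨j, hj⟩
  by_cases h1 : j = i
  · subst h1; simp [hmove, hmoveInv, mul_assoc]
  · by_cases h2 : j = i + 1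
    · subst h2; simp [hmove, hmoveInv]
    · simp [hmove, hmoveInv, h1, h2]

theorem hmoveInv_hmove (i : ℕ) (hi : i + 1 < n) (t : Fin n → G) :
    hmoveInv n G i hi (hmove n G i hi t) = t := by
  funext ⟨j, hj⟩
  by_cases h1 : j = i
  · subst h1; simp [hmove, hmoveInv]
  · by_cases h2 : j = i + 1
    · subst h2; simp [hmove, hmoveInv, mul_assoc]
    · simp [hmove, hmoveInv, h1, h2]

theorem map_hmove (f : G →* H) (i : ℕ) (hi : i + 1 < n) (t : Fin n → G) :
    f ∘ hmove n G i hi t = hmove n H i hi (f ∘ t) := by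
  funext j
  simp only [hmove, Function.comp_apply]
  split_ifs <;> simp

theorem map_hmoveInv (f : G →* H) (i : ℕ) (hi : i + 1 < n) (t : Fin n → G) :
    f ∘ hmoveInv n G i hi t = hmoveInv n H i hi (f ∘ t) := by
  funext j
  simp only [hmoveInv, Function.comp_apply]
  split_ifs <;> simp

theorem prod_ofFn_hmove (i : ℕ) (hi : i + 1 < n) (t : Fin n → G) :
    (List.ofFn (hmove n G i hi t)).prod = (List.ofFn t).prod := by
  induction n generalizing i with
  | zero => omega
  | succ n ih =>
    rcases i with _ | i
    · obtain ⟨n, rfl⟩ : ∃ k, n = k + 1 := ⟨n - 1, by omega⟩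
      have h : ∀ j : Fin n, hmove (n + 1 + 1) G 0 hi t j.succ.succ = t j.succ.succ := by
        intro j; simp [hmove]
      rw [List.ofFn_succ, List.ofFn_succ, List.ofFn_succ (f := t), List.ofFn_succ]
      simp only [List.prod_cons, h]
      simp [hmove, mul_assoc]
    · have h0 : hmove (n + 1) G (i + 1) hi t 0 = t 0 := by simp [hmove]
      have h : (fun j : Fin n => hmove (n + 1) G (i + 1) hi t j.succ)
          = hmove n G i (by omega) fun j => t j.succ := by
        funext j; simp [hmove]
      rw [List.ofFn_succ, List.ofFn_succ (f := t), List.prod_cons, List.prod_cons, h0, h, ih]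

theorem prod_ofFn_hmoveInv (i : ℕ) (hi : i + 1 < n) (t : Fin n → G) :
    (List.ofFn (hmoveInv n G i hi t)).prod = (List.ofFn t).prod := by
  rw [← prod_ofFn_hmove i hi, hmove_hmoveInv]

theorem hmove_mem {S : Set G} (hS : ∀ g, ∀ x ∈ S, g * x * g⁻¹ ∈ S) (i : ℕ) (hi : i + 1 < n)
    {t : Fin n → G} (ht : ∀ j, t j ∈ S) (j : Fin n) : hmove n G i hi t j ∈ S := by
  unfold hmove
  split_ifs
  · exact hS _ _ (ht _)
  · exact ht _
  · exact ht _

theorem hmoveInv_mem {S : Set G} (hS : ∀ g, ∀ x ∈ S, g * x * g⁻¹ ∈ S) (i : ℕ) (hi : i + 1 < n)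
    {t : Fin n → G} (ht : ∀ j, t j ∈ S) (j : Fin n) : hmoveInv n G i hi t j ∈ S := by
  unfold hmoveInv
  split_ifs
  · exact ht _
  · simpa using hS (t ⟨i + 1, hi⟩)⁻¹ _ (ht ⟨i, by omega⟩)
  · exact ht _

end Hurwitz

theorem Refl.conj_mem {n : ℕ} (g x : UCox n) (hx : x ∈ Refl n) : g * x * g⁻¹ ∈ Refl n := by
  obtain ⟨w, i, rfl⟩ := hx
  exact ⟨g * w, i, by group⟩

theorem Rset.conj_mem {n : ℕ} (g x : FreeGroup (Fin n)) (hx : x ∈ Rset n) :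
    g * x * g⁻¹ ∈ Rset n := by
  obtain ⟨w, i, rfl⟩ := hx
  exact ⟨g * w, i, by group⟩

theorem RedT.hmove_mem {n : ℕ} {t : Fin n → UCox n} (ht : t ∈ RedT n) (i : ℕ) (hi : i + 1 < n) :
    hmove n _ i hi t ∈ RedT n :=
  ⟨_root_.hmove_mem Refl.conj_mem i hi ht.1, (prod_ofFn_hmove i hi t).trans ht.2⟩

theorem RedT.hmoveInv_mem {n : ℕ} {t : Fin n → UCox n} (ht : t ∈ RedT n) (i : ℕ)
    (hi : i + 1 < n) : hmoveInv n _ i hi t ∈ RedT n :=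
  ⟨_root_.hmoveInv_mem Refl.conj_mem i hi ht.1, (prod_ofFn_hmoveInv i hi t).trans ht.2⟩

theorem RedR.hmove_mem {n : ℕ} {t : Fin n → FreeGroup (Fin n)} (ht : t ∈ RedR n) (i : ℕ)
    (hi : i + 1 < n) : hmove n _ i hi t ∈ RedR n :=
  ⟨_root_.hmove_mem Rset.conj_mem i hi ht.1, (prod_ofFn_hmove i hi t).trans ht.2⟩

theorem RedR.hmoveInv_mem {n : ℕ} {t : Fin n → FreeGroup (Fin n)} (ht : t ∈ RedR n) (i : ℕ)
    (hi : i + 1 < n) : hmoveInv n _ i hi t ∈ RedR n :=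
  ⟨_root_.hmoveInv_mem Rset.conj_mem i hi ht.1, (prod_ofFn_hmoveInv i hi t).trans ht.2⟩

theorem sgen_mul_self {n : ℕ} (i : Fin n) : (sgen i : UCox n) * sgen i = 1 :=
  PresentedGroup.one_of_mem (rels := coxRels n) (x := FreeGroup.of i * FreeGroup.of i) ⟨i, rfl⟩

theorem sgen_inv {n : ℕ} (i : Fin n) : (sgen i : UCox n)⁻¹ = sgen i :=
  inv_eq_of_mul_eq_one_left (sgen_mul_self i)

/-- A family of involutions in a group `G` extends to a homomorphism from `UCox n`. -/
def UCox.lift {n : ℕ} {G : Type*} [Group G] (f : Fin n → G) (hf : ∀ i, f i * f i = 1) :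
    UCox n →* G :=
  PresentedGroup.toGroup (f := f) (rels := coxRels n) (by rintro r ⟨i, rfl⟩; simp [hf])

@[simp]
theorem UCox.lift_sgen {n : ℕ} {G : Type*} [Group G] (f : Fin n → G) (hf : ∀ i, f i * f i = 1)
    (i : Fin n) : UCox.lift f hf (sgen i) = f i :=
  PresentedGroup.toGroup.of _

theorem closure_range_sgen (n : ℕ) :
    Subgroup.closure (Set.range (sgen : Fin n → UCox n)) = ⊤ :=
  PresentedGroup.closure_range_of _

/-- Every element of a group generated by involutions is a product of generators in which
consecutive factors are distinct. -/
theorem exists_chain_list {ι G : Type*} [Group G] {p : ι → G} (hp : ∀ i, p i * p i = 1)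
    (hgen : Subgroup.closure (Set.range p) = ⊤) (h : G) :
    ∃ l : List ι, l.IsChain (· ≠ ·) ∧ (l.map p).prod = h := by
  have key : ∀ (i : ι) (y : G), (∃ l : List ι, l.IsChain (· ≠ ·) ∧ (l.map p).prod = y) →
      ∃ l : List ι, l.IsChain (· ≠ ·) ∧ (l.map p).prod = p i * y := by
    rintro i y ⟨l, hl, rfl⟩
    rcases l with _ | ⟨j, l⟩
    · exact ⟨[i], by simp, by simp⟩
    · by_cases hij : i = j
      · subst hij
        exact ⟨l, hl.tail, by rw [List.map_cons, List.prod_cons, ← mul_assoc, hp, one_mul]⟩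
      · exact ⟨i :: j :: l, List.isChain_cons_cons.2 ⟨hij, hl⟩, by simp⟩
  have hh : h ∈ Subgroup.closure (Set.range p) := hgen ▸ Subgroup.mem_top h
  induction hh using Subgroup.closure_induction_left with
  | one => exact ⟨[], by simp, by simp⟩
  | mul_left x hx y _ ih => obtain ⟨i, rfl⟩ := hx; exact key i y ih
  | inv_mul_cancel x hx y _ ih =>
    obtain ⟨i, rfl⟩ := hx
    rw [inv_eq_of_mul_eq_one_left (hp i)]
    exact key i y ih

/-! ### An action of the universal Coxeter group on the rational circle -/

/-- The cyclic order on a linear order. -/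
def Cyc {X : Type*} [LT X] (a b c : X) : Prop :=
  a < b ∧ b < c ∨ b < c ∧ c < a ∨ c < a ∧ a < b

theorem Cyc.rotate {X : Type*} [LT X] {a b c : X} (h : Cyc a b c) : Cyc b c a := by
  unfold Cyc at *; tauto

/-- A self-map exchanging `{x ≤ p}` and `{x > p}`, increasing on each of the two pieces,
preserves the cyclic order. -/
theorem Cyc.map_of_exchange {X : Type*} [LinearOrder X] {f : X → X} {p : X}
    (h1 : ∀ x ≤ p, p < f x) (h2 : ∀ x, p < x → f x ≤ p)
    (h3 : ∀ x y, x < y → y ≤ p → f x < f y) (h4 : ∀ x y, p < x → x < y → f x < f y)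
    {a b c : X} (h : Cyc a b c) : Cyc (f a) (f b) (f c) := by
  have key : ∀ x y, x ≤ p → p < y → f y < f x := fun x y hx hy => (h2 y hy).trans_lt (h1 x hx)
  have inc : ∀ x y z, x < y → y < z → Cyc (f x) (f y) (f z) := by
    intro x y z hxy hyz
    rcases le_or_gt x p with hx | hx
    · rcases le_or_gt y p with hy | hy
      · rcases le_or_gt z p with hz | hz
        · exact Or.inl ⟨h3 _ _ hxy hy, h3 _ _ hyz hz⟩
        · exact Or.inr (Or.inr ⟨key _ _ hx hz, h3 _ _ hxy hy⟩)
      · exact Or.inr (Or.inl ⟨h4 _ _ hy hyz, key _ _ hx (hy.trans hyz)⟩)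
    · exact Or.inl ⟨h4 _ _ hx hxy, h4 _ _ (hx.trans hxy) hyz⟩
  rcases h with ⟨u, v⟩ | ⟨u, v⟩ | ⟨u, v⟩
  · exact inc _ _ _ u v
  · exact (inc _ _ _ u v).rotate.rotate
  · exact (inc _ _ _ u v).rotate

/-- The underlying map of `halfTurn`. -/
def halfTurnFun (c : ℚ) : WithTop ℚ → WithTop ℚ
  | none => (c : WithTop ℚ)
  | some x => if x = c then ⊤ else ((c - 1 / (x - c) : ℚ) : WithTop ℚ)

theorem halfTurnFun_top (c : ℚ) : halfTurnFun c ⊤ = c := rfl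

theorem halfTurnFun_self (c : ℚ) : halfTurnFun c c = ⊤ := if_pos rfl

theorem halfTurnFun_coe {c x : ℚ} (h : x ≠ c) :
    halfTurnFun c x = ((c - 1 / (x - c) : ℚ) : WithTop ℚ) := if_neg h

theorem halfTurnFun_involutive (c : ℚ) : Function.Involutive (halfTurnFun c) := by
  intro x
  induction x with
  | top => rw [halfTurnFun_top, halfTurnFun_self]
  | coe x =>
    by_cases h : x = c
    · rw [h, halfTurnFun_self, halfTurnFun_top]
    · have h0 : x - c ≠ 0 := sub_ne_zero.2 h
      have h1 : c - 1 / (x - c) ≠ c := by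
        intro h2
        have : 1 / (x - c) = 0 := by linarith
        exact one_div_ne_zero h0 this
      rw [halfTurnFun_coe h, halfTurnFun_coe h1]
      congr 1
      field_simp
      ring

/-- The half turn of the rational circle exchanging `⊤` and `c`. -/
def halfTurn (c : ℚ) : Equiv.Perm (WithTop ℚ) := (halfTurnFun_involutive c).toPerm

theorem halfTurn_mul_self (c : ℚ) : halfTurn c * halfTurn c = 1 :=
  Equiv.ext (halfTurnFun_involutive c)

theorem Cyc.halfTurn (c : ℚ) {x y z : WithTop ℚ} (h : Cyc x y z) :
    Cyc (halfTurn c x) (halfTurn c y) (halfTurn c z) := by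
  refine Cyc.map_of_exchange (f := halfTurnFun c) (p := c) ?_ ?_ ?_ ?_ h
  · intro x hx
    induction x with
    | top => simp at hx
    | coe x =>
      have hx := WithTop.coe_le_coe.1 hx
      rcases hx.eq_or_lt with rfl | hx
      · rw [halfTurnFun_self]; exact WithTop.coe_lt_top _
      · rw [halfTurnFun_coe hx.ne, WithTop.coe_lt_coe]
        have : 1 / (x - c) < 0 := one_div_neg.2 (by linarith)
        linarith
  · intro x hx
    induction x with
    | top => rw [halfTurnFun_top]
    | coe x =>
      have hx := WithTop.coe_lt_coe.1 hx
      rw [halfTurnFun_coe hx.ne', WithTop.coe_le_coe]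
      have : 0 < 1 / (x - c) := one_div_pos.2 (by linarith)
      linarith
  · intro x y hxy hy
    induction y with
    | top => simp at hy
    | coe y =>
      induction x with
      | top => simp at hxy
      | coe x =>
        have hy := WithTop.coe_le_coe.1 hy
        have hxy := WithTop.coe_lt_coe.1 hxy
        rw [halfTurnFun_coe (hxy.trans_le hy).ne]
        rcases hy.eq_or_lt with rfl | hy
        · rw [halfTurnFun_self]; exact WithTop.coe_lt_top _
        · rw [halfTurnFun_coe hy.ne, WithTop.coe_lt_coe]
          have : 1 / (y - c) < 1 / (x - c) :=
            one_div_lt_one_div_of_neg_of_lt (by linarith) (by linarith)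
          linarith
  · intro x y hx hxy
    induction x with
    | top => simp at hxy
    | coe x =>
      have hx := WithTop.coe_lt_coe.1 hx
      rw [halfTurnFun_coe hx.ne']
      induction y with
      | top =>
        rw [halfTurnFun_top, WithTop.coe_lt_coe]
        have : 0 < 1 / (x - c) := one_div_pos.2 (by linarith)
        linarith
      | coe y =>
        have hxy := WithTop.coe_lt_coe.1 hxy
        rw [halfTurnFun_coe (hx.trans hxy).ne', WithTop.coe_lt_coe]
        have : 1 / (y - c) < 1 / (x - c) :=
          one_div_lt_one_div_of_lt (by linarith) (by linarith)
        linarith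

/-- The action of `UCox m` on the rational circle in which the generator `s_i` exchanges
`2 i` and `2 i + 2`. -/
def act (m : ℕ) : UCox m →* Equiv.Perm (WithTop ℚ) :=
  UCox.lift (fun i => halfTurn (2 * (i : ℕ) + 1)) fun _ => halfTurn_mul_self _

theorem act_mul {m : ℕ} (v w : UCox m) (x : WithTop ℚ) :
    act m (v * w) x = act m v (act m w x) := by
  rw [map_mul, Equiv.Perm.mul_apply]

theorem act_one {m : ℕ} (x : WithTop ℚ) : act m 1 x = x := by simp

theorem Cyc.act {m : ℕ} (w : UCox m) {x y z : WithTop ℚ} (h : Cyc x y z) :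
    Cyc (act m w x) (act m w y) (act m w z) := by
  obtain ⟨l, -, rfl⟩ := exists_chain_list sgen_mul_self (closure_range_sgen m) w
  induction l with
  | nil => simpa [act_one] using h
  | cons i l ih =>
    simp only [List.map_cons, List.prod_cons, act_mul]
    simpa [_root_.act] using Cyc.halfTurn _ ih

/-- The vertices of the standard polygon. -/
def stdVertex (j : ℕ) : WithTop ℚ := ((2 * j : ℚ) : WithTop ℚ)

theorem act_sgen_stdVertex {m : ℕ} (i : Fin m) :
    act m (sgen i) (stdVertex i) = stdVertex (i + 1) := by
  have h : (2 * ((i : ℕ) : ℚ)) ≠ 2 * ((i : ℕ) : ℚ) + 1 := by linarith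
  simp only [_root_.act, UCox.lift_sgen, stdVertex]
  refine (halfTurnFun_coe h).trans ?_
  congr 1
  push_cast
  norm_num
  ring

/-! ### Polygons and ping-pong -/

section PingPong

variable {m : ℕ} {g : UCox m} {a b x : WithTop ℚ}

theorem act_mem_Ioo (hab : a < b) (h1 : act m g a = b) (h2 : act m g b = a)
    (hx : x ∉ Set.Icc a b) : act m g x ∈ Set.Ioo a b := by
  have h : Cyc a b x := by
    rcases lt_or_ge x a with h | h
    · exact Or.inr (Or.inr ⟨h, hab⟩)
    · exact Or.inl ⟨hab, not_le.1 fun h' => hx ⟨h, h'⟩⟩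
  have h' := h.act g
  rw [h1, h2] at h'
  rcases h' with h' | h' | h'
  · exact absurd h'.1 hab.not_gt
  · exact h'
  · exact absurd h'.2 hab.not_gt

theorem act_notMem_Icc (h1 : act m g a = b) (h2 : act m g b = a)
    (hx : x ∈ Set.Ioo a b) : act m g x ∉ Set.Icc a b := by
  have h' := Cyc.act g (Or.inl hx : Cyc a x b)
  rw [h1, h2] at h'
  rintro ⟨h3, h4⟩
  rcases h' with h' | h' | h'
  · exact absurd h'.1 h4.not_gt
  · exact absurd h'.1 h3.not_gt
  · exact absurd h'.2 h4.not_gt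

end PingPong

/-- Generators `p` of `UCox m` acting as the side pairings of a polygon with vertices `α`. -/
structure IsPolygon {m : ℕ} (p : Fin m → UCox m) (α : ℕ → WithTop ℚ) : Prop where
  lt : ∀ i j, i < j → j ≤ m → α i < α j
  lt_top : ∀ i ≤ m, α i < ⊤
  map : ∀ i : Fin m, act m (p i) (α i) = α (i + 1)
  mul_self : ∀ i, p i * p i = 1
  closure_eq_top : Subgroup.closure (Set.range p) = ⊤

theorem isPolygon_sgen (m : ℕ) : IsPolygon (sgen : Fin m → UCox m) stdVertex where
  lt i j hij _ := by
    have : (i : ℚ) < j := by exact_mod_cast hij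
    exact WithTop.coe_lt_coe.2 (by linarith)
  lt_top i _ := WithTop.coe_lt_top _
  map := act_sgen_stdVertex
  mul_self := sgen_mul_self
  closure_eq_top := closure_range_sgen m

/-- The open arc of the circle cut off by the `i`-th side of a polygon. -/
abbrev openArc (α : ℕ → WithTop ℚ) (i : ℕ) : Set (WithTop ℚ) := Set.Ioo (α i) (α (i + 1))

/-- The closed arc of the circle cut off by the `i`-th side of a polygon. -/
abbrev closedArc (α : ℕ → WithTop ℚ) (i : ℕ) : Set (WithTop ℚ) := Set.Icc (α i) (α (i + 1))

namespace IsPolygon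

variable {m : ℕ} {p : Fin m → UCox m} {α : ℕ → WithTop ℚ}

theorem act_act (h : IsPolygon p α) (i : Fin m) (x : WithTop ℚ) :
    act m (p i) (act m (p i) x) = x := by
  rw [← act_mul, h.mul_self, act_one]

theorem map_succ (h : IsPolygon p α) (i : Fin m) : act m (p i) (α (i + 1)) = α i := by
  rw [← h.map, h.act_act]

theorem lt_succ (h : IsPolygon p α) (i : Fin m) : α i < α (i + 1) := h.lt _ _ (by omega) i.2

theorem le (h : IsPolygon p α) {i j : ℕ} (hij : i ≤ j) (hj : j ≤ m) : α i ≤ α j := by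
  rcases hij.eq_or_lt with rfl | hij
  · exact le_rfl
  · exact (h.lt i j hij hj).le

theorem act_mem_openArc (h : IsPolygon p α) {i : Fin m} {x : WithTop ℚ}
    (hx : x ∉ closedArc α i) : act m (p i) x ∈ openArc α i :=
  act_mem_Ioo (h.lt_succ i) (h.map i) (h.map_succ i) hx

theorem act_notMem_closedArc (h : IsPolygon p α) {i : Fin m} {x : WithTop ℚ}
    (hx : x ∈ openArc α i) : act m (p i) x ∉ closedArc α i :=
  act_notMem_Icc (h.map i) (h.map_succ i) hx

theorem top_notMem_closedArc (h : IsPolygon p α) (i : Fin m) : ⊤ ∉ closedArc α i :=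
  fun hx => (h.lt_top _ i.2).not_ge hx.2

theorem notMem_closedArc_of_ne (h : IsPolygon p α) {i j : Fin m} (hij : i ≠ j) {x : WithTop ℚ}
    (hx : x ∈ openArc α i) : x ∉ closedArc α j := by
  rintro ⟨h1, h2⟩
  rcases lt_or_gt_of_ne hij with h' | h'
  · exact (hx.2.trans_le ((h.le h' j.2.le).trans h1)).false
  · exact (hx.1.trans_le (h2.trans (h.le h' i.2.le))).false

theorem eq_of_mem_openArc (h : IsPolygon p α) {i j : Fin m} {x : WithTop ℚ}
    (hi : x ∈ openArc α i) (hj : x ∈ openArc α j) : i = j := by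
  by_contra hij
  exact h.notMem_closedArc_of_ne hij hi (Set.Ioo_subset_Icc_self hj)

theorem act_prod_mem_openArc (h : IsPolygon p α) {x : WithTop ℚ} (k : Fin m) (l : List (Fin m))
    (hl : (k :: l).IsChain (· ≠ ·)) (hx : ∀ i ∈ (k :: l).getLast?, x ∉ closedArc α i) :
    act m (((k :: l).map p).prod) x ∈ openArc α k := by
  induction l generalizing k with
  | nil => simpa using h.act_mem_openArc (hx k (by simp))
  | cons j l ih =>
    rw [List.map_cons, List.prod_cons, act_mul]
    rw [List.isChain_cons_cons] at hl
    exact h.act_mem_openArc (h.notMem_closedArc_of_ne hl.1.symm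
      (ih j hl.2 (by simpa [List.getLast?_cons_cons] using hx)))

theorem chain_ext (h : IsPolygon p α) {l l' : List (Fin m)} (hl : l.IsChain (· ≠ ·))
    (hl' : l'.IsChain (· ≠ ·)) (heq : (l.map p).prod = (l'.map p).prod) : l = l' := by
  have key : ∀ (k : Fin m) (l : List (Fin m)), (k :: l).IsChain (· ≠ ·) →
      act m (((k :: l).map p).prod) ⊤ ∈ openArc α k := fun k l hl =>
    h.act_prod_mem_openArc k l hl fun i _ => h.top_notMem_closedArc i
  have key' : ∀ (k : Fin m) (l : List (Fin m)), (k :: l).IsChain (· ≠ ·) →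
      ((k :: l).map p).prod ≠ 1 := by
    intro k l hl h1
    have := key k l hl
    rw [h1, act_one] at this
    exact h.top_notMem_closedArc k (Set.Ioo_subset_Icc_self this)
  induction l generalizing l' with
  | nil =>
    rcases l' with _ | ⟨k', l'⟩
    · rfl
    · exact absurd heq.symm (key' k' l' hl')
  | cons k l ih =>
    rcases l' with _ | ⟨k', l'⟩
    · exact absurd heq (key' k l hl)
    · have h1 := key k l hl
      rw [heq] at h1
      obtain rfl := h.eq_of_mem_openArc h1 (key k' l' hl')
      simp only [List.map_cons, List.prod_cons, mul_right_inj] at heq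
      rw [ih hl.tail hl'.tail heq, List.tail_cons]

theorem hmove (h : IsPolygon p α) (i : ℕ) (hi : i + 1 < m) :
    IsPolygon (hmove m _ i hi p)
      (Function.update α (i + 1) (act m (p ⟨i, by omega⟩) (α (i + 2)))) := by
  set b := act m (p ⟨i, by omega⟩) (α (i + 2)) with hb
  have hbc : b ∈ Set.Ioo (α i) (α (i + 1)) :=
    h.act_mem_openArc (i := ⟨i, by omega⟩) fun hx =>
      (h.lt (i + 1) (i + 2) (by omega) hi).not_ge hx.2
  have hinv : (p ⟨i, by omega⟩)⁻¹ = p ⟨i, by omega⟩ :=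
    inv_eq_of_mul_eq_one_left (h.mul_self _)
  refine ⟨?_, ?_, ?_, ?_, ?_⟩
  · intro u v huv hv
    by_cases hu : u = i + 1
    · subst hu
      rw [Function.update_self, Function.update_of_ne (by omega)]
      exact hbc.2.trans (h.lt _ _ huv hv)
    · rw [Function.update_of_ne hu]
      by_cases hv' : v = i + 1
      · subst hv'
        rw [Function.update_self]
        exact (h.le (by omega) (by omega)).trans_lt hbc.1
      · rw [Function.update_of_ne hv']
        exact h.lt _ _ huv hv
  · intro u hu
    by_cases hu' : u = i + 1
    · subst hu'
      rw [Function.update_self]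
      exact hbc.2.trans (h.lt_top _ hu)
    · rw [Function.update_of_ne hu']
      exact h.lt_top _ hu
  · rintro ⟨j, hj⟩
    have e0 := h.map ⟨i, by omega⟩
    have e1 := h.map ⟨i + 1, hi⟩
    dsimp only at e0 e1 ⊢
    by_cases h1 : j = i
    · subst h1
      rw [Function.update_of_ne (by omega), Function.update_self]
      simp only [_root_.hmove, if_true]
      rw [hinv, act_mul, act_mul, e0, e1]
    · by_cases h2 : j = i + 1
      · subst h2
        rw [Function.update_self, Function.update_of_ne (by omega)]
        simp only [_root_.hmove, Nat.add_eq_left, one_ne_zero, if_false, if_true]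
        rw [hb, h.act_act]
      · rw [Function.update_of_ne (by omega), Function.update_of_ne (by omega)]
        simpa only [_root_.hmove, h1, h2, if_false] using h.map ⟨j, hj⟩
  · intro j
    have e0 := h.mul_self ⟨i, by omega⟩
    have e1 := h.mul_self ⟨i + 1, hi⟩
    simp only [_root_.hmove]
    split_ifs
    · calc _ = p ⟨i, by omega⟩ * (p ⟨i + 1, hi⟩ * p ⟨i + 1, hi⟩) * (p ⟨i, by omega⟩)⁻¹ := by group
        _ = 1 := by rw [e1]; group
    · exact e0
    · exact h.mul_self _
  · rw [eq_top_iff, ← h.closure_eq_top, Subgroup.closure_le]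
    have hmem : ∀ j, _root_.hmove m _ i hi p j ∈
        Subgroup.closure (Set.range (_root_.hmove m _ i hi p)) :=
      fun j => Subgroup.subset_closure ⟨j, rfl⟩
    rintro _ ⟨j, rfl⟩
    rw [← congrFun (hmoveInv_hmove i hi p) j]
    conv in _root_.hmoveInv .. => unfold _root_.hmoveInv
    split_ifs
    · exact hmem _
    · exact mul_mem (mul_mem (inv_mem (hmem _)) (hmem _)) (hmem _)
    · exact hmem _

theorem hmoveInv (h : IsPolygon p α) (i : ℕ) (hi : i + 1 < m) :
    IsPolygon (hmoveInv m _ i hi p)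
      (Function.update α (i + 1) (act m (p ⟨i + 1, hi⟩) (α i))) := by
  set b := act m (p ⟨i + 1, hi⟩) (α i) with hb
  have hbc : b ∈ Set.Ioo (α (i + 1)) (α (i + 2)) :=
    h.act_mem_openArc (i := ⟨i + 1, hi⟩) fun hx => (h.lt i (i + 1) (by omega) hi.le).not_ge hx.1
  have hinv : (p ⟨i + 1, hi⟩)⁻¹ = p ⟨i + 1, hi⟩ :=
    inv_eq_of_mul_eq_one_left (h.mul_self _)
  refine ⟨?_, ?_, ?_, ?_, ?_⟩
  · intro u v huv hv
    by_cases hu : u = i + 1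
    · subst hu
      rw [Function.update_self, Function.update_of_ne (by omega)]
      exact hbc.2.trans_le (h.le (by omega) hv)
    · rw [Function.update_of_ne hu]
      by_cases hv' : v = i + 1
      · subst hv'
        rw [Function.update_self]
        exact (h.lt _ _ huv hv).trans hbc.1
      · rw [Function.update_of_ne hv']
        exact h.lt _ _ huv hv
  · intro u hu
    by_cases hu' : u = i + 1
    · subst hu'
      rw [Function.update_self]
      exact hbc.2.trans (h.lt_top _ hi)
    · rw [Function.update_of_ne hu']
      exact h.lt_top _ hu
  · rintro ⟨j, hj⟩
    have e0 := h.map ⟨i, by omega⟩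
    have e1 := h.map ⟨i + 1, hi⟩
    dsimp only at e0 e1 ⊢
    by_cases h1 : j = i
    · subst h1
      rw [Function.update_of_ne (by omega), Function.update_self]
      simp only [_root_.hmoveInv, if_true]
      rfl
    · by_cases h2 : j = i + 1
      · subst h2
        rw [Function.update_self, Function.update_of_ne (by omega)]
        simp only [_root_.hmoveInv, Nat.add_eq_left, one_ne_zero, if_false, if_true]
        rw [hinv, act_mul, act_mul, hb, h.act_act, e0, e1]
      · rw [Function.update_of_ne (by omega), Function.update_of_ne (by omega)]
        simpa only [_root_.hmoveInv, h1, h2, if_false] using h.map ⟨j, hj⟩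
  · intro j
    have e0 := h.mul_self ⟨i, by omega⟩
    have e1 := h.mul_self ⟨i + 1, hi⟩
    simp only [_root_.hmoveInv]
    split_ifs
    · exact e1
    · calc _ = (p ⟨i + 1, hi⟩)⁻¹ * (p ⟨i, by omega⟩ * p ⟨i, by omega⟩) * p ⟨i + 1, hi⟩ := by group
        _ = 1 := by rw [e0]; group
    · exact h.mul_self _
  · rw [eq_top_iff, ← h.closure_eq_top, Subgroup.closure_le]
    have hmem : ∀ j, _root_.hmoveInv m _ i hi p j ∈
        Subgroup.closure (Set.range (_root_.hmoveInv m _ i hi p)) :=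
      fun j => Subgroup.subset_closure ⟨j, rfl⟩
    rintro _ ⟨j, rfl⟩
    rw [← congrFun (hmove_hmoveInv i hi p) j]
    conv in _root_.hmove .. => unfold _root_.hmove
    split_ifs
    · exact mul_mem (mul_mem (hmem _) (hmem _)) (inv_mem (hmem _))
    · exact hmem _
    · exact hmem _

/-- The images of the pair `{⊤, p i ⊤}` under the group all lie in a single arc, except for
the pair itself. -/
theorem eq_or_exists_openArc (h : IsPolygon p α) (i : Fin m) (w : UCox m) :
    w = 1 ∨ w = p i ∨ ∃ k : Fin m, act m w ⊤ ∈ openArc α k ∧ act m (w * p i) ⊤ ∈ openArc α k := by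
  have key : ∀ l : List (Fin m), l.IsChain (· ≠ ·) → (∀ j ∈ l.getLast?, j ≠ i) → l ≠ [] →
      ∃ k : Fin m, act m (l.map p).prod ⊤ ∈ openArc α k ∧
        act m ((l.map p).prod * p i) ⊤ ∈ openArc α k := by
    intro l hl hlast hne
    obtain ⟨k, l, rfl⟩ := List.exists_cons_of_ne_nil hne
    refine ⟨k, h.act_prod_mem_openArc k l hl fun j _ => h.top_notMem_closedArc j, ?_⟩
    rw [act_mul]
    exact h.act_prod_mem_openArc k l hl fun j hj =>
      h.notMem_closedArc_of_ne (hlast j hj).symm (h.act_mem_openArc (h.top_notMem_closedArc i))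
  obtain ⟨l, hl, rfl⟩ := exists_chain_list h.mul_self h.closure_eq_top w
  by_cases hlast : ∀ j ∈ l.getLast?, j ≠ i
  · by_cases hne : l = []
    · exact Or.inl (by simp [hne])
    · exact Or.inr (Or.inr (key l hl hlast hne))
  · push Not at hlast
    obtain ⟨j, hj, rfl⟩ := hlast
    obtain ⟨l, rfl⟩ := List.getLast?_eq_some_iff.1 hj
    rw [List.isChain_append] at hl
    by_cases hne : l = []
    · exact Or.inr (Or.inl (by simp [hne]))
    · obtain ⟨k, h1, h2⟩ := key l hl.1 (fun i hi => hl.2.2 i hi j (by simp)) hne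
      refine Or.inr (Or.inr ⟨k, by simpa using h2, ?_⟩)
      simpa [mul_assoc, h.mul_self] using h1

/-- The pair `{⊤, p i ⊤}` is not separated by any of its images. -/
theorem not_linked (h : IsPolygon p α) (i : Fin m) (w : UCox m) :
    ¬ (Cyc ⊤ (act m w ⊤) (act m (p i) ⊤) ∧ Cyc (act m (p i) ⊤) (act m (w * p i) ⊤) ⊤) := by
  rintro ⟨h1, h2⟩
  set q := act m (p i) ⊤ with hq
  have hqi : q ∈ openArc α i := h.act_mem_openArc (h.top_notMem_closedArc i)
  have htop : ∀ x : WithTop ℚ, ¬ ⊤ < x := fun x => not_top_lt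
  have hP : act m w ⊤ < q := by
    rcases h1 with h1 | h1 | h1
    · exact absurd h1.1 (htop _)
    · exact h1.1
    · exact absurd h1.2 (htop _)
  have hQ : q < act m (w * p i) ⊤ := by
    rcases h2 with h2 | h2 | h2
    · exact h2.1
    · exact absurd h2.2 (htop _)
    · exact absurd h2.1 (htop _)
  rcases h.eq_or_exists_openArc i w with rfl | rfl | ⟨k, hk1, hk2⟩
  · rw [act_one] at hP; exact htop _ hP
  · exact hP.false
  · have hki : k = i := h.eq_of_mem_openArc ⟨hk1.1.trans hP, hQ.trans hk2.2⟩ hqi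
    subst hki
    have hn1 := h.act_notMem_closedArc hk1
    rw [← act_mul] at hn1
    have h1' := h1.act (p k)
    have h2' := h2.act (p k)
    rw [← hq, ← act_mul, hq, h.act_act, ← hq] at h1'
    rw [hq, h.act_act, ← hq, ← act_mul, ← mul_assoc] at h2'
    have hP' : q < act m (p k * w) ⊤ := by
      rcases h1' with h | h | h
      · exact h.1
      · exact absurd h.2 (htop _)
      · exact absurd h.1 (htop _)
    have hQ' : act m (p k * w * p k) ⊤ < q := by
      rcases h2' with h | h | h
      · exact absurd h.1 (htop _)
      · exact h.1
      · exact absurd h.2 (htop _)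
    rcases h.eq_or_exists_openArc k (p k * w) with h3 | h3 | ⟨j, hj1, hj2⟩
    · rw [h3, one_mul] at hQ'; exact hQ'.false
    · rw [h3] at hP'; exact hP'.false
    · have hjk : j = k := h.eq_of_mem_openArc ⟨hj2.1.trans hQ', hP'.trans hj1.2⟩ hqi
      subst hjk
      exact hn1 (Set.Ioo_subset_Icc_self hj1)

/-- The version of `not_linked` with the two image points exchanged. -/
theorem not_linked_swap (h : IsPolygon p α) (i : Fin m) (w : UCox m) :
    ¬ (Cyc ⊤ (act m (w * p i) ⊤) (act m (p i) ⊤) ∧ Cyc (act m (p i) ⊤) (act m w ⊤) ⊤) := by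
  have := h.not_linked i (w * p i)
  rwa [mul_assoc w, h.mul_self, mul_one] at this

end IsPolygon

/-! ### Transitivity of the Hurwitz moves on reflection factorizations -/

/-- The conjugate of the generator `s_a` by the element represented by the word `u`. -/
def conjWord {m : ℕ} (u : List (Fin m)) (a : Fin m) : UCox m :=
  (u.map sgen).prod * sgen a * ((u.map sgen).prod)⁻¹

theorem conjWord_cons {m : ℕ} (d : Fin m) (u : List (Fin m)) (a : Fin m) :
    conjWord (d :: u) a = sgen d * conjWord u a * (sgen d)⁻¹ := by
  simp only [conjWord, List.map_cons, List.prod_cons]; group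

theorem exists_eq_conjWord {m : ℕ} {t : UCox m} (ht : t ∈ Refl m) :
    ∃ u a, t = conjWord u a := by
  obtain ⟨w, i, rfl⟩ := ht
  obtain ⟨l, -, rfl⟩ := exists_chain_list sgen_mul_self (closure_range_sgen m) w
  exact ⟨l, i, rfl⟩

theorem conjWord_inv {m : ℕ} (u : List (Fin m)) (a : Fin m) :
    (conjWord u a)⁻¹ = conjWord u a := by
  simp only [conjWord, mul_inv_rev, inv_inv, sgen_inv, mul_assoc]

theorem prod_map_sgen_reverse {m : ℕ} (u : List (Fin m)) :
    (u.map sgen).reverse.prod = ((u.map sgen).prod)⁻¹ := by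
  induction u with
  | nil => simp
  | cons d u ih => simp [ih, sgen_inv]

theorem exists_shorter_conjWord {m : ℕ} {u : List (Fin m)} {a : Fin m}
    (h : ¬ (u ++ [a]).IsChain (· ≠ ·)) :
    ∃ u', u'.length < u.length ∧ conjWord u' a = conjWord u a := by
  induction u with
  | nil => simp at h
  | cons d u ih =>
    by_cases hu : (u ++ [a]).IsChain (· ≠ ·)
    · rcases u with _ | ⟨e, u⟩
      · have hda : d = a := by simpa using h
        subst hda
        exact ⟨[], by simp, by simp [conjWord]⟩
      · have hde : d = e := by
          by_contra hne
          exact h (List.isChain_cons_cons.2 ⟨hne, hu⟩)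
        subst hde
        refine ⟨u, by simp only [List.length_cons]; omega, ?_⟩
        rw [conjWord_cons, conjWord_cons, sgen_inv]
        calc conjWord u a = 1 * conjWord u a * 1 := by group
          _ = _ := by rw [← sgen_mul_self d]; group
    · obtain ⟨u', h1, h2⟩ := ih hu
      exact ⟨d :: u', by simpa using h1, by rw [conjWord_cons, conjWord_cons, h2]⟩

/-- If neither of `u ++ [a]` and `u' ++ [b]` is a prefix of the other word, the two words
branch off after a common prefix of `u` and `u'`. -/
theorem exists_common_prefix {ι : Type*} (u u' : List ι) (a b : ι) (hab : a ≠ b)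
    (h : ¬ (u ++ [a]) <+: u') (h' : ¬ (u' ++ [b]) <+: u) :
    ∃ c x y, u = c ++ x ∧ u' = c ++ y ∧
      ∀ d ∈ (x ++ [a]).head?, ∀ e ∈ (y ++ [b]).head?, d ≠ e := by
  induction u generalizing u' with
  | nil =>
    refine ⟨[], [], u', rfl, rfl, ?_⟩
    rcases u' with _ | ⟨d, u'⟩
    · simpa using hab
    · simpa using h
  | cons d u ih =>
    rcases u' with _ | ⟨d', u'⟩
    · exact ⟨[], d :: u, [], rfl, rfl, by simpa [eq_comm] using h'⟩
    · by_cases hd : d = d'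
      · subst hd
        obtain ⟨c, x, y, rfl, rfl, hxy⟩ := ih u' (by simpa using h) (by simpa using h')
        exact ⟨d :: c, x, y, rfl, rfl, hxy⟩
      · exact ⟨[], d :: u, d' :: u', rfl, rfl, by simpa using hd⟩

/-- A product of reflections without cancellation between neighbours has a normal form at
least as long as the number of factors. -/
theorem exists_chain_prod_conjWord {m : ℕ} (l : List (List (Fin m) × Fin m)) (u : List (Fin m))
    (a : Fin m) (hred : ∀ q ∈ (u, a) :: l, (q.1 ++ [q.2]).IsChain (· ≠ ·))
    (hl : ((u, a) :: l).IsChain fun q r =>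
      q.2 ≠ r.2 ∧ ¬ (q.1 ++ [q.2]) <+: r.1 ∧ ¬ (r.1 ++ [r.2]) <+: q.1) :
    ∃ z, (u ++ a :: z).IsChain (· ≠ ·) ∧
      (((u, a) :: l).map fun q => conjWord q.1 q.2).prod = ((u ++ a :: z).map sgen).prod ∧
      l.length ≤ z.length ∧ (z.length = l.length → u = [] ∧ ∀ q ∈ l, q.1 = []) := by
  induction l generalizing u a with
  | nil =>
    have h := hred (u, a) (by simp)
    refine ⟨u.reverse, List.isChain_split.2 ⟨h, ?_⟩, ?_, by simp, by simp⟩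
    · have h' : (u ++ [a]).reverse.IsChain (· ≠ ·) := by
        rw [List.isChain_reverse]
        exact h.imp fun _ _ => Ne.symm
      simpa using h'
    · simp [conjWord, prod_map_sgen_reverse, mul_assoc]
  | cons q l ih =>
    obtain ⟨u', b⟩ := q
    rw [List.isChain_cons_cons] at hl
    obtain ⟨⟨hab, hp, hp'⟩, hl⟩ := hl
    obtain ⟨z, hz, hprod, hlen, heq⟩ := ih u' b (fun q hq => hred q (by simp [hq])) hl
    obtain ⟨c, x, y, rfl, rfl, hxy⟩ := exists_common_prefix u u' a b hab hp hp'
    have h := hred (c ++ x, a) (by simp)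
    refine ⟨x.reverse ++ (y ++ b :: z), List.isChain_split.2 ⟨h, ?_⟩, ?_, ?_, ?_⟩
    · have h1 : (x ++ [a]).reverse.IsChain (· ≠ ·) := by
        rw [List.isChain_reverse]
        dsimp only at h
        rw [List.append_assoc] at h
        exact (List.isChain_append.1 h).2.1.imp fun _ _ => Ne.symm
      have h2 : (y ++ b :: z).IsChain (· ≠ ·) := by
        rw [List.append_assoc] at hz
        exact (List.isChain_append.1 hz).2.1
      have h3 : ((x ++ [a]).reverse ++ (y ++ b :: z)).IsChain (· ≠ ·) := by
        refine List.isChain_append.2 ⟨h1, h2, ?_⟩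
        rw [List.getLast?_reverse]
        have : (y ++ b :: z).head? = (y ++ [b]).head? := by cases y <;> simp
        rwa [this]
      simpa using h3
    · rw [List.map_cons, List.prod_cons, hprod]
      simp [conjWord, prod_map_sgen_reverse, mul_assoc]
    · simp only [List.length_append, List.length_reverse, List.length_cons]; omega
    · intro hzl
      simp only [List.length_append, List.length_reverse, List.length_cons] at hzl
      have hx : x = [] := List.length_eq_zero_iff.1 (by omega)
      have hy : y = [] := List.length_eq_zero_iff.1 (by omega)
      obtain ⟨h1, h2⟩ := heq (by omega)
      subst hx hy
      refine ⟨h1, ?_⟩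
      intro q hq
      rcases List.mem_cons.1 hq with rfl | hq
      · exact h1
      · exact h2 q hq

/-- The homomorphism counting occurrences of the `k`-th generator modulo two. -/
def parity {m : ℕ} (k : Fin m) : UCox m →* Multiplicative (ZMod 2) :=
  UCox.lift (fun i => if i = k then Multiplicative.ofAdd 1 else 1) fun i => by
    split_ifs <;> decide

theorem injective_of_mem_RedT {m : ℕ} {p : Fin m → UCox m} (hp : p ∈ RedT m)
    {U : Fin m → List (Fin m)} {A : Fin m → Fin m} (hU : ∀ j, p j = conjWord (U j) (A j)) :
    Function.Injective A := by
  rw [Finite.injective_iff_surjective]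
  intro k
  by_contra! hk
  have h := congrArg (parity k) hp.2
  have h1 : parity k (List.ofFn p).prod = 1 := by
    rw [map_list_prod, List.map_ofFn, List.prod_ofFn]
    refine Finset.prod_eq_one fun j _ => ?_
    simp [hU, conjWord, parity, hk]
  have h2 : parity k (coxElt m) = Multiplicative.ofAdd 1 := by
    rw [coxElt, map_list_prod, List.map_ofFn, List.prod_ofFn]
    simp [parity]
  rw [h1, h2] at h
  exact absurd h (by decide)

theorem coxElt_eq (m : ℕ) : coxElt m = ((List.finRange m).map sgen).prod := by
  rw [coxElt, List.ofFn_eq_map]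

theorem isChain_finRange (m : ℕ) : (List.finRange m).IsChain (· ≠ ·) :=
  (List.nodup_finRange m).isChain

/-- A factorization of the Coxeter element into reflections that cannot be shortened by a
Hurwitz move is the standard one. -/
theorem eq_sgen_of_reduced {m : ℕ} {p : Fin m → UCox m} (hp : p ∈ RedT m)
    {U : Fin m → List (Fin m)} {A : Fin m → Fin m} (hU : ∀ j, p j = conjWord (U j) (A j))
    (hred : ∀ j, (U j ++ [A j]).IsChain (· ≠ ·))
    (hadj : ∀ (i : ℕ) (hi : i + 1 < m),
      ¬ (U ⟨i, by omega⟩ ++ [A ⟨i, by omega⟩]) <+: U ⟨i + 1, hi⟩ ∧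
      ¬ (U ⟨i + 1, hi⟩ ++ [A ⟨i + 1, hi⟩]) <+: U ⟨i, by omega⟩) :
    p = sgen := by
  have hinj := injective_of_mem_RedT hp hU
  have hnil : ∀ j, U j = [] := by
    rcases m with _ | m
    · exact fun j => j.elim0
    have hofFn : (List.ofFn fun j => (U j, A j)) =
        (U 0, A 0) :: List.ofFn fun j : Fin m => (U j.succ, A j.succ) := List.ofFn_succ
    have hchain := (List.isChain_ofFn (f := fun j => (U j, A j)) (r := fun q r =>
      q.2 ≠ r.2 ∧ ¬ (q.1 ++ [q.2]) <+: r.1 ∧ ¬ (r.1 ++ [r.2]) <+: q.1)).2 fun i hi =>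
        ⟨fun h => absurd (congrArg Fin.val (hinj h)) (by simp), hadj i hi⟩
    rw [hofFn] at hchain
    obtain ⟨z, hz, hprod, hlen, heq⟩ := exists_chain_prod_conjWord _ (U 0) (A 0) (by
      rw [← hofFn]
      intro q hq
      obtain ⟨j, rfl⟩ := (List.mem_ofFn' _ _).1 hq
      exact hred j) hchain
    rw [← hofFn, List.map_ofFn] at hprod
    have hp' : (fun q : List (Fin (m + 1)) × Fin (m + 1) => conjWord q.1 q.2) ∘
        (fun j => (U j, A j)) = p := by
      funext j; exact (hU j).symm
    rw [hp', hp.2, coxElt_eq] at hprod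
    have hl := congrArg List.length
      ((isPolygon_sgen (m + 1)).chain_ext (isChain_finRange _) hz hprod)
    simp only [List.length_finRange, List.length_append, List.length_cons,
      List.length_ofFn] at hl hlen heq
    obtain ⟨h0, h1⟩ := heq (by omega)
    intro j
    refine Fin.cases h0 (fun j => ?_) j
    exact h1 (U j.succ, A j.succ) ((List.mem_ofFn' _ _).2 ⟨j, rfl⟩)
  have hpA : p = sgen ∘ A := by
    funext j; simp [hU, hnil, conjWord]
  have hA : List.ofFn A = List.finRange m := by
    refine (isPolygon_sgen m).chain_ext ?_ (isChain_finRange m) ?_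
    · exact List.isChain_ofFn.2 fun i hi h => absurd (congrArg Fin.val (hinj h)) (by simp)
    · rw [← coxElt_eq, ← hp.2, List.map_ofFn, hpA]
  rw [hpA, List.ofFn_injective (hA.trans (List.ofFn_id m).symm), Function.comp_id]

theorem conj_conjWord {m : ℕ} (u v : List (Fin m)) (a b : Fin m) :
    conjWord u a * conjWord (u ++ [a] ++ v) b * (conjWord u a)⁻¹ = conjWord (u ++ v) b := by
  rw [conjWord_inv]
  have h : conjWord u a * ((u ++ [a] ++ v).map sgen).prod = ((u ++ v).map sgen).prod := by
    simp only [conjWord, List.map_append, List.prod_append, List.map_cons, List.map_nil,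
      List.prod_cons, List.prod_nil]
    calc _ = (u.map sgen).prod * (sgen a * sgen a) * (v.map sgen).prod := by group
      _ = _ := by rw [sgen_mul_self]; group
  rw [conjWord.eq_def (u ++ v), ← h, conjWord.eq_def (u ++ [a] ++ v), mul_inv_rev, conjWord_inv]
  group

/-- Induction principle for reflection factorizations of the Coxeter element: the Hurwitz
moves and their inverses act transitively. -/
theorem RedT.induction {m : ℕ} {Q : (Fin m → UCox m) → Prop} (h0 : Q sgen)
    (h1 : ∀ p ∈ RedT m, ∀ i hi, Q p → Q (hmove m _ i hi p))
    (h2 : ∀ p ∈ RedT m, ∀ i hi, Q p → Q (hmoveInv m _ i hi p)) :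
    ∀ p ∈ RedT m, Q p := by
  have key : ∀ (N : ℕ) (U : Fin m → List (Fin m)) (A : Fin m → Fin m), ∀ p ∈ RedT m,
      (∀ j, p j = conjWord (U j) (A j)) → ∑ j, (U j).length = N → Q p := by
    intro N
    induction N using Nat.strong_induction_on with
    | _ N ih =>
    intro U A p hp hU hN
    by_cases hred : ∀ j, (U j ++ [A j]).IsChain (· ≠ ·)
    swap
    · push Not at hred
      obtain ⟨k, hk⟩ := hred
      obtain ⟨u, hu, hu'⟩ := exists_shorter_conjWord hk
      refine ih _ ?_ (Function.update U k u) A p hp (fun j => ?_) rfl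
      · rw [← hN]
        refine Finset.sum_lt_sum (fun j _ => ?_) ⟨k, Finset.mem_univ _, by simpa using hu⟩
        by_cases hj : j = k
        · subst hj; simpa using hu.le
        · simp [hj]
      · by_cases hj : j = k
        · subst hj; simp [hu', hU]
        · simp [hj, hU]
    by_cases hadj : ∀ (i : ℕ) (hi : i + 1 < m),
      ¬ (U ⟨i, by omega⟩ ++ [A ⟨i, by omega⟩]) <+: U ⟨i + 1, hi⟩ ∧
      ¬ (U ⟨i + 1, hi⟩ ++ [A ⟨i + 1, hi⟩]) <+: U ⟨i, by omega⟩
    · rwa [eq_sgen_of_reduced hp hU hred hadj]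
    push Not at hadj
    obtain ⟨i, hi, hadj⟩ := hadj
    set x : Fin m := ⟨i, by omega⟩ with hx
    set y : Fin m := ⟨i + 1, hi⟩ with hy
    have hxy : x ≠ y := fun h => absurd (congrArg Fin.val h) (by simp [hx, hy])
    have hval : ∀ j : Fin m, ((j : ℕ) = i ↔ j = x) ∧ ((j : ℕ) = i + 1 ↔ j = y) := by
      intro j; simp [hx, hy, Fin.ext_iff]
    by_cases hpre : (U x ++ [A x]) <+: U y
    · obtain ⟨v, hv⟩ := hpre
      rw [← hmoveInv_hmove i hi p]
      refine h2 _ (RedT.hmove_mem hp i hi) i hi ?_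
      refine ih _ ?_ (Function.update (Function.update U x (U x ++ v)) y (U x))
        (A ∘ Equiv.swap x y) _ (RedT.hmove_mem hp i hi) (fun j => ?_) rfl
      · rw [← hN, ← Equiv.sum_comp (Equiv.swap x y) fun j => (U j).length]
        have hlt : (U x ++ v).length < (U y).length := by
          rw [← hv]; simp only [List.length_append, List.length_singleton]; omega
        refine Finset.sum_lt_sum (fun j _ => ?_) ⟨x, Finset.mem_univ _, ?_⟩
        · by_cases hjx : j = x
          · subst hjx; simpa [hxy] using hlt.le
          · by_cases hjy : j = y
            · subst hjy; simp
            · simp [hjx, hjy, Equiv.swap_apply_of_ne_of_ne]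
        · simpa [hxy] using hlt
      · by_cases hjx : j = x
        · subst hjx
          simp only [hmove, if_pos ((hval _).1.2 rfl), Function.comp_apply,
            Function.update_of_ne hxy, Function.update_self, Equiv.swap_apply_left]
          rw [← conj_conjWord, hv, ← hU, ← hU]
        · by_cases hjy : j = y
          · subst hjy
            simp only [hmove, if_neg ((hval _).1.not.2 hjx), if_pos ((hval _).2.2 rfl),
              Function.comp_apply, Function.update_self, Equiv.swap_apply_right]
            exact hU x
          · simp [hmove, hval, hjx, hjy, Equiv.swap_apply_of_ne_of_ne, hU]
    · obtain ⟨v, hv⟩ := hadj hpre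
      rw [← hmove_hmoveInv i hi p]
      refine h1 _ (RedT.hmoveInv_mem hp i hi) i hi ?_
      refine ih _ ?_ (Function.update (Function.update U y (U y ++ v)) x (U y))
        (A ∘ Equiv.swap x y) _ (RedT.hmoveInv_mem hp i hi) (fun j => ?_) rfl
      · rw [← hN, ← Equiv.sum_comp (Equiv.swap x y) fun j => (U j).length]
        have hlt : (U y ++ v).length < (U x).length := by
          rw [← hv]; simp only [List.length_append, List.length_singleton]; omega
        refine Finset.sum_lt_sum (fun j _ => ?_) ⟨y, Finset.mem_univ _, ?_⟩
        · by_cases hjy : j = y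
          · subst hjy; simpa [hxy.symm] using hlt.le
          · by_cases hjx : j = x
            · subst hjx; simp
            · simp [hjx, hjy, Equiv.swap_apply_of_ne_of_ne]
        · simpa [hxy.symm] using hlt
      · by_cases hjx : j = x
        · subst hjx
          simp only [hmoveInv, if_pos ((hval _).1.2 rfl), Function.comp_apply,
            Function.update_self, Equiv.swap_apply_left]
          exact hU y
        · by_cases hjy : j = y
          · subst hjy
            simp only [hmoveInv, if_neg ((hval _).1.not.2 hjx), if_pos ((hval _).2.2 rfl),
              Function.comp_apply, Function.update_of_ne hjx, Function.update_self,
              Equiv.swap_apply_right]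
            rw [← conj_conjWord, hv, ← hU, ← hU, hU y, conjWord_inv, ← hU y]
          · simp [hmoveInv, hval, hjx, hjy, Equiv.swap_apply_of_ne_of_ne, hU]
  intro p hp
  choose U A hU using fun j => exists_eq_conjWord (hp.1 j)
  exact key _ U A p hp hU rfl

theorem RedT.exists_isPolygon {m : ℕ} {p : Fin m → UCox m} (hp : p ∈ RedT m) :
    ∃ α, IsPolygon p α := by
  refine RedT.induction (Q := fun p => ∃ α, IsPolygon p α) ⟨_, isPolygon_sgen m⟩ ?_ ?_ p hp
  · rintro p - i hi ⟨α, h⟩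
    exact ⟨_, h.hmove i hi⟩
  · rintro p - i hi ⟨α, h⟩
    exact ⟨_, h.hmoveInv i hi⟩

/-! ### Ping-pong for powers of a product of two adjacent sides -/

namespace IsPolygon

variable {m : ℕ} {p : Fin m → UCox m} {α : ℕ → WithTop ℚ}

theorem act_prod_top_notMem_closedArc (h : IsPolygon p α) {l : List (Fin m)}
    (hl : l.IsChain (· ≠ ·)) {j : Fin m} (hj : ∀ z ∈ l.head?, z ≠ j) :
    act m (l.map p).prod ⊤ ∉ closedArc α j := by
  rcases l with _ | ⟨k, l⟩
  · simpa using h.top_notMem_closedArc j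
  · exact h.notMem_closedArc_of_ne (hj k (by simp))
      (h.act_prod_mem_openArc k l hl fun i _ => h.top_notMem_closedArc i)

theorem act_mul_mem_openArc (h : IsPolygon p α) {i j : Fin m} (hij : i ≠ j) {x : WithTop ℚ}
    (hx : x ∉ closedArc α j) : act m (p i * p j) x ∈ openArc α i := by
  rw [act_mul]
  exact h.act_mem_openArc (h.notMem_closedArc_of_ne hij.symm (h.act_mem_openArc hx))

theorem act_pow_mem_openArc (h : IsPolygon p α) {i j : Fin m} (hij : i ≠ j) {x : WithTop ℚ}
    (hx : x ∉ closedArc α j) (r : ℕ) : act m ((p i * p j) ^ (r + 1)) x ∈ openArc α i := by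
  induction r with
  | zero => simpa using h.act_mul_mem_openArc hij hx
  | succ r ih =>
    rw [pow_succ', act_mul]
    exact h.act_mul_mem_openArc hij (h.notMem_closedArc_of_ne hij ih)

theorem cyc_pow (h : IsPolygon p α) {i j : Fin m} (hij : (j : ℕ) = i + 1) {x y : WithTop ℚ}
    (hxi : x ∉ closedArc α i) (hxj : x ∉ closedArc α j) (hyi : y ∉ closedArc α i)
    (hyj : y ∉ closedArc α j) (r : ℕ) :
    Cyc (act m (p i * p j) y) (act m ((p i * p j) ^ (r + 2)) y)
      (act m ((p j * p i) ^ (r + 1)) x) ∧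
    Cyc (act m ((p j * p i) ^ (r + 1)) x) x (act m (p i * p j) y) := by
  have hne : i ≠ j := fun e => by rw [e] at hij; omega
  set z := act m ((p i * p j) ^ (r + 1)) y
  have hzi : z ∈ openArc α i := h.act_pow_mem_openArc hne hyj r
  have h1 := h.act_mul_mem_openArc hne hyj
  have h2 : act m ((p i * p j) ^ (r + 2)) y ∈ openArc α i := h.act_pow_mem_openArc hne hyj _
  have h3 := h.act_pow_mem_openArc hne.symm hxi r
  have h4 : act m ((p i * p j) ^ (r + 2)) y = act m (p i * p j) z := by
    rw [pow_succ', act_mul]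
  have hα := h.lt_succ i
  have hβ := h.lt_succ j
  have e1 := h.map_succ j
  have e2 := h.map_succ i
  simp only [openArc, closedArc, hij, Set.mem_Ioo, Set.mem_Icc, not_and, not_le] at *
  have hc : Cyc (α (i + 1 + 1)) y z := by
    rcases lt_or_ge y (α i) with hy | hy
    · exact Or.inr (Or.inl ⟨hy.trans hzi.1, hzi.2.trans hβ⟩)
    · exact Or.inr (Or.inr ⟨hzi.2.trans hβ, hyj (hyi hy).le⟩)
  have hc' := hc.act (p i * p j)
  rw [act_mul, e1, e2, ← h4] at hc'
  have hlt : act m (p i * p j) y < act m ((p i * p j) ^ (r + 2)) y := by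
    rcases hc' with hc' | hc' | hc'
    · exact hc'.2
    · exact absurd hc'.2 h2.1.not_gt
    · exact absurd hc'.1 h2.1.not_gt
  refine ⟨Or.inl ⟨hlt, h2.2.trans h3.1⟩, ?_⟩
  rcases lt_or_ge x (α i) with hx | hx
  · exact Or.inr (Or.inl ⟨hx.trans h1.1, h1.2.trans h3.1⟩)
  · exact Or.inr (Or.inr ⟨h1.2.trans h3.1, h3.2.trans (hxj (hxi hx).le)⟩)

theorem cyc_pow_swap (h : IsPolygon p α) {i j : Fin m} (hij : (j : ℕ) = i + 1) {x y : WithTop ℚ}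
    (hxi : x ∉ closedArc α i) (hxj : x ∉ closedArc α j) (hyi : y ∉ closedArc α i)
    (hyj : y ∉ closedArc α j) (r : ℕ) :
    Cyc (act m ((p i * p j) ^ (r + 1)) x) (act m ((p j * p i) ^ (r + 2)) y)
      (act m (p j * p i) y) ∧
    Cyc (act m (p j * p i) y) x (act m ((p i * p j) ^ (r + 1)) x) := by
  have hne : j ≠ i := fun e => by rw [e] at hij; omega
  set z := act m ((p j * p i) ^ (r + 1)) y
  have hzj : z ∈ openArc α j := h.act_pow_mem_openArc hne hyi r
  have h1 := h.act_mul_mem_openArc hne hyi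
  have h2 : act m ((p j * p i) ^ (r + 2)) y ∈ openArc α j := h.act_pow_mem_openArc hne hyi _
  have h3 := h.act_pow_mem_openArc hne.symm hxj r
  have h4 : act m ((p j * p i) ^ (r + 2)) y = act m (p j * p i) z := by
    rw [pow_succ', act_mul]
  have hα := h.lt_succ i
  have hβ := h.lt_succ j
  have e1 := h.map j
  have e2 := h.map i
  simp only [openArc, closedArc, hij, Set.mem_Ioo, Set.mem_Icc, not_and, not_le] at *
  have hc : Cyc z y (α i) := by
    rcases lt_or_ge y (α i) with hy | hy
    · exact Or.inr (Or.inl ⟨hy, hα.trans hzj.1⟩)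
    · exact Or.inr (Or.inr ⟨hα.trans hzj.1, hzj.2.trans (hyj (hyi hy).le)⟩)
  have hc' := hc.act (p j * p i)
  rw [act_mul _ _ (α i), e2, e1, ← h4] at hc'
  have hlt : act m ((p j * p i) ^ (r + 2)) y < act m (p j * p i) y := by
    rcases hc' with hc' | hc' | hc'
    · exact hc'.1
    · exact absurd hc'.2 h2.2.not_gt
    · exact absurd hc'.1 h2.2.not_gt
  refine ⟨Or.inl ⟨h3.2.trans h2.1, hlt⟩, ?_⟩
  rcases lt_or_ge x (α i) with hx | hx
  · exact Or.inr (Or.inl ⟨hx.trans h3.1, h3.2.trans h1.1⟩)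
  · exact Or.inr (Or.inr ⟨h3.2.trans h1.1, h1.2.trans (hxj (hxi hx).le)⟩)

end IsPolygon

/-! ### Cabling: doubling the strands -/

section Cable

variable {n : ℕ}

/-- The first of the two strands replacing the `k`-th strand. -/
def cableFst (k : Fin n) : Fin (n * 2) := ⟨k * 2 + 0, by omega⟩

/-- The second of the two strands replacing the `k`-th strand. -/
def cableSnd (k : Fin n) : Fin (n * 2) := ⟨k * 2 + 1, by omega⟩

/-- The homomorphism sending the generator `f_k` to the product of the two reflections
attached to the strands replacing the `k`-th strand. -/
def cable (n : ℕ) : FreeGroup (Fin n) →* UCox (n * 2) :=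
  FreeGroup.lift fun k => sgen (cableFst k) * sgen (cableSnd k)

/-- The word of length two representing the image of a letter under `cable`. -/
def cableLetter (x : Fin n × Bool) : List (Fin (n * 2)) :=
  if x.2 then [cableFst x.1, cableSnd x.1] else [cableSnd x.1, cableFst x.1]

/-- The word representing the image of a word under `cable`. -/
def cableWord (L : List (Fin n × Bool)) : List (Fin (n * 2)) := L.flatMap cableLetter

theorem cableWord_append (L L' : List (Fin n × Bool)) :
    cableWord (L ++ L') = cableWord L ++ cableWord L' := List.flatMap_append

theorem cable_mk (L : List (Fin n × Bool)) :
    cable n (FreeGroup.mk L) = ((cableWord L).map sgen).prod := by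
  rw [cable, FreeGroup.lift_mk]
  induction L with
  | nil => rfl
  | cons x L ih =>
    obtain ⟨k, e⟩ := x
    rw [List.map_cons, List.prod_cons, ih, cableWord, cableWord, List.flatMap_cons]
    cases e <;> simp [cableLetter, sgen_inv, mul_assoc]

theorem val_div_two_of_mem_head? {L : List (Fin n × Bool)} {z : Fin (n * 2)}
    (hz : z ∈ (cableWord L).head?) : ∃ x ∈ L.head?, (z : ℕ) / 2 = x.1 := by
  rcases L with _ | ⟨⟨k, e⟩, L⟩
  · simp [cableWord] at hz
  · refine ⟨(k, e), by simp, ?_⟩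
    cases e <;> simp [cableWord, cableLetter] at hz <;> subst hz <;>
      simp only [cableFst, cableSnd] <;> omega

theorem val_div_two_of_mem_getLast? {L : List (Fin n × Bool)} {z : Fin (n * 2)}
    (hz : z ∈ (cableWord L).getLast?) : ∃ x ∈ L.getLast?, (z : ℕ) / 2 = x.1 := by
  induction L using List.reverseRecOn with
  | nil => simp [cableWord] at hz
  | append_singleton L x _ =>
    obtain ⟨k, e⟩ := x
    refine ⟨(k, e), by simp, ?_⟩
    cases e <;> simp [cableWord, cableLetter] at hz <;> subst hz <;>
      simp only [cableFst, cableSnd] <;> omega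

theorem isChain_cableWord {L : List (Fin n × Bool)} (hL : FreeGroup.IsReduced L) :
    (cableWord L).IsChain (· ≠ ·) := by
  induction L with
  | nil => simp [cableWord]
  | cons x L ih =>
    have hx : ∀ e : Bool, (cableLetter (x.1, e)).IsChain (· ≠ ·) := by
      intro e
      cases e <;> simp [cableLetter, cableFst, cableSnd]
    refine List.isChain_append.2 ⟨hx x.2, ih (List.IsChain.tail hL), ?_⟩
    rcases L with _ | ⟨y, L⟩
    · simp
    · have hxy := (List.isChain_cons_cons.1 hL).1
      obtain ⟨k, e⟩ := x
      obtain ⟨k', e'⟩ := y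
      cases e <;> cases e' <;>
        simp [cableLetter, cableFst, cableSnd, Fin.ext_iff] at hxy ⊢ <;> omega

/-- The cabling of a factorization of `gElt` is a factorization of `coxElt`. -/
theorem cable_mem_RedT {t : Fin n → FreeGroup (Fin n)} (ht : (List.ofFn t).prod = gElt n)
    {w : Fin n → FreeGroup (Fin n)} {a : Fin n → Fin n}
    (hw : ∀ i, t i = w i * FreeGroup.of (a i) * (w i)⁻¹) :
    (fun j : Fin (n * 2) => cable n (w ⟨j / 2, by omega⟩) *
      sgen ⟨a ⟨j / 2, by omega⟩ * 2 + j % 2, by omega⟩ * (cable n (w ⟨j / 2, by omega⟩))⁻¹) ∈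
      RedT (n * 2) := by
  refine ⟨fun j => ⟨_, _, rfl⟩, ?_⟩
  trans cable n (gElt n)
  · rw [← ht, map_list_prod, List.ofFn_mul, List.prod_flatten, List.map_ofFn, List.map_ofFn]
    congr 2
    funext i
    have e0 : ∀ h : ((i : ℕ) * 2 + 0) / 2 < n, (⟨((i : ℕ) * 2 + 0) / 2, h⟩ : Fin n) = i := by
      intro h; ext; simp
    have e1 : ∀ h : ((i : ℕ) * 2 + 1) / 2 < n, (⟨((i : ℕ) * 2 + 1) / 2, h⟩ : Fin n) = i := by
      intro h; ext; simp; omega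
    simp only [Function.comp_apply, List.ofFn_succ, List.ofFn_zero, List.prod_cons, List.prod_nil,
      Fin.val_zero, Fin.succ_zero_eq_one, Fin.val_one, e0, e1]
    rw [hw, map_mul, map_mul, map_inv, cable, FreeGroup.lift_apply_of]
    simp [cableFst, cableSnd, mul_assoc, Nat.add_mod]
  · rw [gElt, coxElt, map_list_prod, List.ofFn_mul, List.prod_flatten, List.map_ofFn,
      List.map_ofFn]
    congr 2

end Cable

/-! ### Uniqueness of the lift of the standard factorization -/

theorem pr_mk {n : ℕ} (L : List (Fin n × Bool)) :
    pr n (FreeGroup.mk L) = ((L.map Prod.fst).map sgen).prod := by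
  rw [pr, FreeGroup.lift_mk, List.map_map]
  congr 2
  funext ⟨k, e⟩
  cases e <;> simp [sgen_inv]

/-- Every conjugate of a generator has a representation without obvious cancellation. -/
theorem exists_reduced_conj {n : ℕ} {g : FreeGroup (Fin n)} (hg : g ∈ Rset n) :
    ∃ (L : List (Fin n × Bool)) (a : Fin n), FreeGroup.IsReduced L ∧
      (∀ x ∈ L.getLast?, x.1 ≠ a) ∧
      g = FreeGroup.mk L * FreeGroup.of a * (FreeGroup.mk L)⁻¹ := by
  obtain ⟨w, a, rfl⟩ := hg
  have key : ∀ L : List (Fin n × Bool), FreeGroup.IsReduced L →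
      ∃ L' : List (Fin n × Bool), FreeGroup.IsReduced L' ∧ (∀ x ∈ L'.getLast?, x.1 ≠ a) ∧
        FreeGroup.mk L * FreeGroup.of a * (FreeGroup.mk L)⁻¹ =
          FreeGroup.mk L' * FreeGroup.of a * (FreeGroup.mk L')⁻¹ := by
    intro L
    induction L using List.reverseRecOn with
    | nil => exact fun h => ⟨[], h, by simp, rfl⟩
    | append_singleton L x ih =>
      intro h
      obtain ⟨b, e⟩ := x
      by_cases hb : b = a
      · subst hb
        obtain ⟨L', h1, h2, h3⟩ := ih (List.isChain_append.1 h).1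
        refine ⟨L', h1, h2, ?_⟩
        rw [← h3, ← FreeGroup.mul_mk]
        cases e
        · have : FreeGroup.mk [(b, false)] = (FreeGroup.of b)⁻¹ := rfl
          rw [this]; group
        · have : FreeGroup.mk [(b, true)] = FreeGroup.of b := rfl
          rw [this]; group
      · exact ⟨L ++ [(b, e)], h, by simpa using hb, rfl⟩
  obtain ⟨L', h1, h2, h3⟩ := key w.toWord FreeGroup.isReduced_toWord
  rw [FreeGroup.mk_toWord] at h3
  exact ⟨L', a, h1, h2, h3⟩

/-- A reduced word with a repeated index contains a maximal power of exponent at least two. -/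
theorem exists_power_of_not_isChain {ι : Type*} {L : List (ι × Bool)}
    (hL : FreeGroup.IsReduced L) (h : ¬ (L.map Prod.fst).IsChain (· ≠ ·)) :
    ∃ (x y : List (ι × Bool)) (r : ℕ) (k : ι) (e : Bool),
      L = x ++ List.replicate (r + 2) (k, e) ++ y ∧
      (∀ z ∈ x.getLast?, z.1 ≠ k) ∧ ∀ z ∈ y.head?, z.1 ≠ k := by
  induction L with
  | nil => simp at h
  | cons c L ih =>
    have hL' : FreeGroup.IsReduced L := List.IsChain.tail hL
    by_cases hc : (L.map Prod.fst).IsChain (· ≠ ·)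
    · rcases L with _ | ⟨d, L⟩
      · simp at h
      · have hcd : c.1 = d.1 := by
          by_contra hne
          exact h (List.isChain_cons_cons.2 ⟨hne, hc⟩)
        have hcd' : c = d := Prod.ext hcd ((List.isChain_cons_cons.1 hL).1 hcd)
        subst hcd'
        refine ⟨[], L, 0, c.1, c.2, rfl, by simp, ?_⟩
        rcases L with _ | ⟨d, L⟩
        · simp
        · simpa [eq_comm] using (List.isChain_cons_cons.1 hc).1
    · obtain ⟨x, y, r, k, e, rfl, hx, hy⟩ := ih hL' hc
      rcases x with _ | ⟨d, x⟩
      · by_cases hck : c.1 = k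
        · have hce : c = (k, e) := Prod.ext hck ((List.isChain_cons_cons.1 hL).1 hck)
          subst hce
          exact ⟨[], y, r + 1, k, e, rfl, by simp, hy⟩
        · exact ⟨[c], y, r, k, e, rfl, by simpa using hck, hy⟩
      · exact ⟨c :: d :: x, y, r, k, e, rfl, by simpa [List.getLast?_cons_cons] using hx, hy⟩

/-- In a word conjugating a generator into a factor of `gElt`, no index is repeated. -/
theorem isChain_fst_of_mem_RedR {n : ℕ} {t : Fin n → FreeGroup (Fin n)}
    (ht : (List.ofFn t).prod = gElt n) {L : Fin n → List (Fin n × Bool)} {a : Fin n → Fin n}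
    (hL : ∀ i, FreeGroup.IsReduced (L i)) (hlast : ∀ i, ∀ x ∈ (L i).getLast?, x.1 ≠ a i)
    (hw : ∀ i, t i = FreeGroup.mk (L i) * FreeGroup.of (a i) * (FreeGroup.mk (L i))⁻¹)
    (i : Fin n) : ((L i).map Prod.fst).IsChain (· ≠ ·) := by
  by_contra hnot
  obtain ⟨q, α, hα, hτ⟩ : ∃ q α, IsPolygon q α ∧ q (cableFst i) =
      cable n (FreeGroup.mk (L i)) * sgen (cableFst (a i)) * (cable n (FreeGroup.mk (L i)))⁻¹ := by
    obtain ⟨α, hα⟩ := RedT.exists_isPolygon (cable_mem_RedT ht hw)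
    exact ⟨_, α, hα, by simp [cableFst]⟩
  have hlink := hα.not_linked (cableFst i)
  have hlink' := hα.not_linked_swap (cableFst i)
  rw [hτ] at hlink hlink'
  clear hτ hα
  specialize hL i
  specialize hlast i
  generalize L i = L at *
  generalize a i = a at *
  obtain ⟨x, y, r, k, e, rfl, hx, hy⟩ := exists_power_of_not_isChain hL hnot
  set w := cable n (FreeGroup.mk (x ++ List.replicate (r + 2) (k, e) ++ y)) with hwdef
  set X := cable n (FreeGroup.mk x) with hX
  set u := cable n (FreeGroup.mk [(k, e)]) with hu
  set Y := cable n (FreeGroup.mk y) with hY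
  have hwX : w = X * u ^ (r + 2) * Y := by
    have : FreeGroup.mk (List.replicate (r + 2) (k, e)) = FreeGroup.mk [(k, e)] ^ (r + 2) := by
      rw [FreeGroup.pow_mk]; simp
    rw [hwdef, ← FreeGroup.mul_mk, ← FreeGroup.mul_mk, this, map_mul, map_mul, map_pow]
  have hpoly := isPolygon_sgen (n * 2)
  have hchain : (cableWord (x ++ List.replicate (r + 2) (k, e) ++ y)).IsChain (· ≠ ·) :=
    isChain_cableWord hL
  have hfull : (cableWord (x ++ List.replicate (r + 2) (k, e) ++ y) ++ cableFst a ::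
      (cableWord (x ++ List.replicate (r + 2) (k, e) ++ y)).reverse).IsChain (· ≠ ·) := by
    have h1 : (cableWord (x ++ List.replicate (r + 2) (k, e) ++ y) ++ [cableFst a]).IsChain
        (· ≠ ·) := by
      refine List.isChain_append.2 ⟨hchain, by simp, ?_⟩
      rintro z hz _ hy rfl
      obtain ⟨q, hq, hzq⟩ := val_div_two_of_mem_getLast? hz
      refine hlast q hq (Fin.ext ?_)
      rw [← hzq]
      simp only [List.head?_cons, Option.mem_def, Option.some.injEq] at hy
      simp [← hy, cableFst]
    refine List.isChain_split.2 ⟨h1, ?_⟩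
    have h2 := List.isChain_reverse.2 (h1.imp fun _ _ => Ne.symm : List.IsChain _ _)
    simpa using h2
  have hdiv : ∀ z : Fin (n * 2), (z : ℕ) / 2 ≠ k → z ≠ cableFst k ∧ z ≠ cableSnd k := by
    rintro z hz
    constructor
    · rintro rfl; exact hz (by simp [cableFst])
    · rintro rfl; exact hz (by simp only [cableSnd]; omega)
  have hP : ∀ z ∈ (cableWord x).reverse.head?, (z : ℕ) / 2 ≠ k := by
    intro z hz hzk
    rw [List.head?_reverse] at hz
    obtain ⟨q, hq, hzq⟩ := val_div_two_of_mem_getLast? hz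
    exact hx q hq (Fin.ext (by rw [← hzq, hzk]))
  have hP' : (cableWord x).reverse.IsChain (· ≠ ·) := by
    rw [cableWord_append, cableWord_append, List.append_assoc] at hchain
    exact List.isChain_reverse.2 ((List.isChain_append.1 hchain).1.imp fun _ _ => Ne.symm)
  have hPX : (((cableWord x).reverse).map sgen).prod = X⁻¹ := by
    rw [List.map_reverse, prod_map_sgen_reverse, hX, cable_mk]
  set l := cableWord y ++ cableFst a ::
      (cableWord (x ++ List.replicate (r + 2) (k, e) ++ y)).reverse with hl
  have hQ : ∀ z ∈ l.head?, (z : ℕ) / 2 ≠ k := by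
    intro z hz hzk
    rcases y with _ | ⟨d, y⟩
    · have hza : cableFst a = z := by simpa [hl, cableWord] using hz
      refine hlast (k, e) ?_ (Fin.ext ?_)
      · simp [List.replicate_succ']
      · rw [← hzk, ← hza]; simp [cableFst]
    · have hz' : z ∈ (cableWord (d :: y)).head? := by
        rw [hl, List.head?_append_of_ne_nil] at hz
        · exact hz
        · cases h : d.2 <;> simp [cableWord, cableLetter, h]
      obtain ⟨q, hq, hzq⟩ := val_div_two_of_mem_head? hz'
      exact hy q hq (Fin.ext (by rw [← hzq, hzk]))
  have hQ' : l.IsChain (· ≠ ·) := by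
    rw [cableWord_append _ y] at hfull hl
    rw [List.append_assoc] at hfull
    rw [hl]
    exact (List.isChain_append.1 hfull).2.1
  have hlY : (l.map sgen).prod = Y * sgen (cableFst a) * w⁻¹ := by
    rw [hl, List.map_append, List.prod_append, List.map_cons, List.prod_cons, List.map_reverse,
      prod_map_sgen_reverse, ← cable_mk, ← cable_mk, mul_assoc]
  have hxi := hpoly.act_prod_top_notMem_closedArc hP' fun z hz => (hdiv z (hP z hz)).1
  have hxj := hpoly.act_prod_top_notMem_closedArc hP' fun z hz => (hdiv z (hP z hz)).2
  have hyi := hpoly.act_prod_top_notMem_closedArc hQ' fun z hz => (hdiv z (hQ z hz)).1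
  have hyj := hpoly.act_prod_top_notMem_closedArc hQ' fun z hz => (hdiv z (hQ z hz)).2
  rw [hPX] at hxi hxj
  rw [hlY] at hyi hyj
  have hv1 : X * u ^ (r + 1) * u⁻¹ ^ (r + 1) * X⁻¹ = 1 := by group
  have hv2 : X * u ^ (r + 1) * u * (Y * sgen (cableFst a) * w⁻¹) =
      w * sgen (cableFst a) * w⁻¹ := by
    have h : X * u ^ (r + 1) * u * Y = w := by rw [hwX, mul_assoc X, ← pow_succ]
    rw [← mul_assoc, ← mul_assoc, h]
  have hv3 : X * u ^ (r + 1) * u ^ (r + 2) * (Y * sgen (cableFst a) * w⁻¹) =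
      X * u ^ (r + 1) * X⁻¹ * (w * sgen (cableFst a) * w⁻¹) := by
    rw [← hv2, pow_succ u (r + 1)]
    group
  specialize hlink (X * u ^ (r + 1) * X⁻¹)
  specialize hlink' (X * u ^ (r + 1) * X⁻¹)
  rw [← hv3, ← hv2] at hlink hlink'
  have hsucc : ((cableSnd k : Fin (n * 2)) : ℕ) = cableFst k + 1 := rfl
  have htop : act (n * 2) (X * u ^ (r + 1))
      (act (n * 2) (u⁻¹ ^ (r + 1)) (act (n * 2) X⁻¹ ⊤)) = ⊤ := by
    rw [← act_mul, ← act_mul, hv1, act_one]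
  cases e
  · have hu' : u = sgen (cableSnd k) * sgen (cableFst k) := by
      rw [hu, cable_mk]; simp [cableWord, cableLetter]
    have hui : u⁻¹ = sgen (cableFst k) * sgen (cableSnd k) := by
      rw [hu', mul_inv_rev, sgen_inv, sgen_inv]
    obtain ⟨h1, h2⟩ := hpoly.cyc_pow_swap hsucc hxi hxj hyi hyj r
    rw [← hui, ← hu'] at h1 h2
    have h1' := h1.act (X * u ^ (r + 1))
    have h2' := h2.act (X * u ^ (r + 1))
    rw [htop] at h1' h2'
    simp only [← act_mul, ← mul_assoc] at h1' h2' hlink'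
    exact hlink' ⟨h1', h2'⟩
  · have hu' : u = sgen (cableFst k) * sgen (cableSnd k) := by
      rw [hu, cable_mk]; simp [cableWord, cableLetter]
    have hui : u⁻¹ = sgen (cableSnd k) * sgen (cableFst k) := by
      rw [hu', mul_inv_rev, sgen_inv, sgen_inv]
    obtain ⟨h1, h2⟩ := hpoly.cyc_pow hsucc hxi hxj hyi hyj r
    rw [← hui, ← hu'] at h1 h2
    have h1' := h1.act (X * u ^ (r + 1))
    have h2' := h2.act (X * u ^ (r + 1))
    rw [htop] at h1' h2'
    simp only [← act_mul, ← mul_assoc] at h1' h2' hlink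
    exact hlink ⟨h2', h1'⟩

theorem eq_of_of_pr_eq_sgen {n : ℕ} {t : Fin n → FreeGroup (Fin n)} (ht : t ∈ RedR n)
    (hpr : pr n ∘ t = sgen) : t = FreeGroup.of := by
  choose L a hL hlast hw using fun i => exists_reduced_conj (ht.1 i)
  funext i
  have hchain := isChain_fst_of_mem_RedR ht.2 hL hlast hw i
  set U := (L i).map Prod.fst with hU
  have hUa : (U ++ [a i]).IsChain (· ≠ ·) := by
    refine List.isChain_append.2 ⟨hchain, by simp, ?_⟩
    intro z hz z' hz'
    obtain ⟨q, hq, rfl⟩ : ∃ q ∈ (L i).getLast?, q.1 = z := by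
      rw [hU, List.getLast?_map] at hz
      simpa using hz
    obtain rfl : a i = z' := by simpa using hz'
    exact hlast i q hq
  have h := congrFun hpr i
  rw [Function.comp_apply, hw, map_mul, map_mul, map_inv, pr_mk, ← hU, pr,
    FreeGroup.lift_apply_of] at h
  have hlist : U ++ a i :: U.reverse = [i] := by
    refine (isPolygon_sgen n).chain_ext (List.isChain_split.2 ⟨hUa, ?_⟩) (by simp) ?_
    · simpa using List.isChain_reverse.2 (hUa.imp fun _ _ => Ne.symm : List.IsChain _ _)
    · simpa [prod_map_sgen_reverse, mul_assoc] using h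
  have hnil : U = [] := by
    have := congrArg List.length hlist
    simp only [List.length_append, List.length_cons, List.length_reverse, List.length_nil] at this
    exact List.length_eq_zero_iff.1 (by omega)
  have hLi : L i = [] := List.map_eq_nil_iff.1 hnil
  have hai : a i = i := by simpa [hnil] using hlist
  rw [hw, hLi, hai, ← FreeGroup.one_eq_mk]
  simp

theorem of_mem_RedR (n : ℕ) : (FreeGroup.of : Fin n → FreeGroup (Fin n)) ∈ RedR n :=
  ⟨fun i => ⟨1, i, by simp⟩, rfl⟩

theorem pr_comp_of (n : ℕ) : pr n ∘ FreeGroup.of = sgen := by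
  funext i; simp [pr]

theorem pr_comp_mem_RedT {n : ℕ} {t : Fin n → FreeGroup (Fin n)} (ht : t ∈ RedR n) :
    pr n ∘ t ∈ RedT n := by
  refine ⟨fun i => ?_, ?_⟩
  · obtain ⟨w, k, hk⟩ := ht.1 i
    exact ⟨pr n w, k, by simp [hk, pr]⟩
  · rw [← List.map_ofFn, ← map_list_prod, ht.2, gElt, coxElt, map_list_prod, List.map_ofFn]
    congr 2

/-- Every reflection factorization of `coxElt` lifts uniquely to a factorization of `gElt`. -/
theorem existsUnique_lift {n : ℕ} {p : Fin n → UCox n} (hp : p ∈ RedT n) :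
    ∃! t, t ∈ RedR n ∧ pr n ∘ t = p := by
  refine RedT.induction (Q := fun p => ∃! t, t ∈ RedR n ∧ pr n ∘ t = p) ?_ ?_ ?_ p hp
  · exact ⟨_, ⟨of_mem_RedR n, pr_comp_of n⟩, fun t ht => eq_of_of_pr_eq_sgen ht.1 ht.2⟩
  · rintro p - i hi ⟨t, ⟨ht, rfl⟩, huniq⟩
    refine ⟨_, ⟨RedR.hmove_mem ht i hi, map_hmove _ i hi t⟩, ?_⟩
    rintro t' ⟨ht', hpr⟩
    rw [← huniq (hmoveInv n _ i hi t') ⟨RedR.hmoveInv_mem ht' i hi, ?_⟩, hmove_hmoveInv]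
    rw [map_hmoveInv, hpr, hmoveInv_hmove]
  · rintro p - i hi ⟨t, ⟨ht, rfl⟩, huniq⟩
    refine ⟨_, ⟨RedR.hmoveInv_mem ht i hi, map_hmoveInv _ i hi t⟩, ?_⟩
    rintro t' ⟨ht', hpr⟩
    rw [← huniq (hmove n _ i hi t') ⟨RedR.hmove_mem ht' i hi, ?_⟩, hmoveInv_hmove]
    rw [map_hmove, hpr, hmove_hmoveInv]

/-- The coordinatewise projection `π^n : Red_R(g) → Red_T(c)` is a bijection,
equivariant for the Hurwitz actions on both sides. -/
theorem projection_bijection_equivariant (n : ℕ) :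
    Set.BijOn (fun t => pr n ∘ t) (RedR n) (RedT n) ∧
    (∀ (t : Fin n → FreeGroup (Fin n)) (i : ℕ) (hi : i + 1 < n),
      pr n ∘ hmove n (FreeGroup (Fin n)) i hi t = hmove n (UCox n) i hi (pr n ∘ t)) := by
  refine ⟨⟨fun t ht => pr_comp_mem_RedT ht, ?_, ?_⟩, fun t i hi => map_hmove (pr n) i hi t⟩
  · intro t ht t' ht' h
    exact (existsUnique_lift (pr_comp_mem_RedT ht)).unique ⟨ht, rfl⟩ ⟨ht', h.symm⟩
  · intro p hp
    obtain ⟨t, ht, -⟩ := existsUnique_lift hp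
    exact ⟨t, ht⟩
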